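/- Let n be a nonzero integer. Define q(n) to be the number of integer quadratic polynomials f(x) = ax^2 + bx + c with a(b^2 - 4ac) = n, counted up to the substitution x ↦ x + t for t ∈ ℤ. Define q_2^+(n) to be the number of such classes with b even and b^2 - 4ac > 0. Then q_2^+(4n) = q(n). -/

import Mathlib

/-- The superdiscriminant `I(f) = a*(b^2 - 4*a*c)` of the integer quadratic
polynomial `f(x) = a*x^2 + b*x + c`, encoded as the triple `(a, b, c)`. -/
def superdisc (p : ℤ × ℤ × ℤ) : ℤ := p.1 * (p.2.1 ^ 2 - 4 * p.1 * p.2.2)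

/-- Equivalence of integer quadratics under the substitution `x ↦ x + t`, `t ∈ ℤ`:
`a*(x+t)^2 + b*(x+t) + c = a*x^2 + (b + 2*a*t)*x + (a*t^2 + b*t + c)`. -/
def quadEquiv (p q : ℤ × ℤ × ℤ) : Prop :=
  ∃ t : ℤ, q = (p.1, p.2.1 + 2 * p.1 * t, p.1 * t ^ 2 + p.2.1 * t + p.2.2)

/-- The number of equivalence classes (under `x ↦ x + t`) of integer quadratics
with superdiscriminant `n` satisfying the extra condition `P`. -/
noncomputable def quadCount (n : ℤ) (P : ℤ × ℤ × ℤ → Prop) : ℕ :=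
  Nat.card (Quot (fun p q : {p : ℤ × ℤ × ℤ // superdisc p = n ∧ P p} =>
    quadEquiv p.1 q.1))

open Finset in
lemma card_filter_range_mul (P : ℕ → Prop) [DecidablePred P] (q k : ℕ)
    (h : ∀ x, P (x + q) ↔ P x) : #{x ∈ range (k * q) | P x} = k * #{x ∈ range q | P x} := by
  simp only [← Nat.count_eq_card_filter_range]
  induction k with
  | zero => simp
  | succ k ih =>
    rw [Nat.succ_mul, add_comm, Nat.count_add, Nat.succ_mul, ← ih, add_comm]
    simp only [add_comm q, h]

/-- The number of square roots of `D` modulo `a`. -/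
noncomputable def sqrtCount (a : ℕ) (D : ℤ) : ℕ := Nat.card {x : ZMod a // x ^ 2 = (D : ZMod a)}

open Finset in
lemma sqrtCount_eq_card {a : ℕ} (ha : a ≠ 0) (D : ℤ) :
    sqrtCount a D = #((range a).filter fun b : ℕ => (a : ℤ) ∣ (b : ℤ) ^ 2 - D) := by
  have : NeZero a := ⟨ha⟩
  rw [sqrtCount, Nat.card_eq_fintype_card, Fintype.card_subtype]
  refine card_nbij' ZMod.val (fun b => (b : ZMod a)) ?_ ?_ ?_ ?_
  · intro x hx
    have hx : x ^ 2 = D := by simpa using hx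
    simp only [coe_filter, mem_range, Set.mem_ofPred_eq, ZMod.val_lt, true_and]
    rw [← ZMod.intCast_zmod_eq_zero_iff_dvd]
    push_cast
    simp [hx]
  · intro b hb
    have hb : b < a ∧ (a : ℤ) ∣ (b : ℤ) ^ 2 - D := by simpa using hb
    have h := (ZMod.intCast_zmod_eq_zero_iff_dvd _ _).2 hb.2
    push_cast at h
    simpa using sub_eq_zero.1 h
  · intro x _
    simp
  · intro b hb
    have hb : b < a ∧ (a : ℤ) ∣ (b : ℤ) ^ 2 - D := by simpa using hb
    exact ZMod.val_cast_of_lt hb.1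

lemma sqrtCount_congr {a : ℕ} {D D' : ℤ} (h : (a : ℤ) ∣ D - D') :
    sqrtCount a D = sqrtCount a D' := by
  have h := (ZMod.intCast_zmod_eq_zero_iff_dvd _ _).2 h
  push_cast at h
  rw [sqrtCount, sub_eq_zero.1 h, sqrtCount]

lemma sqrtCount_mul {a b : ℕ} (h : a.Coprime b) (D : ℤ) :
    sqrtCount (a * b) D = sqrtCount a D * sqrtCount b D := by
  rw [sqrtCount, sqrtCount, sqrtCount, ← Nat.card_prod]
  let e := ZMod.chineseRemainder h
  refine Nat.card_congr ((e.toEquiv.subtypeEquiv (q := fun x => x.1 ^ 2 = (D : ZMod a) ∧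
    x.2 ^ 2 = (D : ZMod b)) fun x => ?_).trans (Equiv.subtypeProdEquivProd (p := fun x : ZMod a =>
      x ^ 2 = (D : ZMod a)) (q := fun x : ZMod b => x ^ 2 = (D : ZMod b))))
  have : x ^ 2 = (D : ZMod (a * b)) ↔ e x ^ 2 = e D := by
    rw [← map_pow, e.injective.eq_iff]
  rw [this, map_intCast, Prod.ext_iff]
  simp

lemma sqrtCount_mul_sq {a y : ℕ} (h : y.Coprime a) (D : ℤ) :
    sqrtCount a (D * y ^ 2) = sqrtCount a D := by
  symm
  let u := ZMod.unitOfCoprime y h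
  refine Nat.card_congr (u.mulRight.subtypeEquiv fun x => ?_)
  have hu : (u : ZMod a) = y := rfl
  simp only [Units.mulRight_apply, mul_pow, hu]
  push_cast
  rw [← hu]
  exact ((u.isUnit.pow 2).mul_left_inj).symm

lemma sqrtCount_one (D : ℤ) : sqrtCount 1 D = 1 := by
  rw [sqrtCount_eq_card one_ne_zero]
  simp

open Finset in
lemma two_mul_card_half {a : ℕ} (ha : a ≠ 0) (D : ℤ) :
    sqrtCount (4 * a) D = 2 * 
      #((range (2 * a)).filter fun b : ℕ => (4 * a : ℤ) ∣ (b : ℤ) ^ 2 - D) := by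
  rw [sqrtCount_eq_card (by omega), show 4 * a = 2 * (2 * a) by ring,
    card_filter_range_mul _ (2 * a) 2]
  · congr 3
    ext b
    push_cast
    ring_nf
  · intro x
    rw [← Int.dvd_add_right (a := (2 * (2 * a) : ℕ)) (b := - (4 * a * (x + a)))]
    · push_cast
      ring_nf
    · exact ⟨-(x + a), by push_cast; ring⟩

open Finset in
lemma sqrtCount_prime_sq_mul {p : ℕ} (hp : p.Prime) {a : ℕ} (ha : a ≠ 0) (D : ℤ) :
    sqrtCount (p ^ 2 * a) (p ^ 2 * D) = p * sqrtCount a D := by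
  have hp0 := hp.ne_zero
  rw [sqrtCount_eq_card (by positivity), sqrtCount_eq_card ha,
    ← card_filter_range_mul _ a p]
  · symm
    have key (b : ℕ) : ((p ^ 2 * a : ℕ) : ℤ) ∣ ((p * b : ℕ) : ℤ) ^ 2 - p ^ 2 * D ↔
        (a : ℤ) ∣ (b : ℤ) ^ 2 - D := by
      rw [← mul_dvd_mul_iff_left (a := (p : ℤ) ^ 2) (b := (a : ℤ)) (by positivity)]
      push_cast
      ring_nf
    refine card_nbij (fun b => p * b) ?_ ?_ ?_
    · intro b hb
      have hb : b < p * a ∧ (a : ℤ) ∣ (b : ℤ) ^ 2 - D := by simpa using hb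
      simp only [coe_filter, mem_range, Set.mem_ofPred_eq]
      refine ⟨?_, (key b).2 hb.2⟩
      have := Nat.mul_lt_mul_of_pos_left hb.1 hp.pos
      linarith
    · intro b _ b' _ h
      exact Nat.eq_of_mul_eq_mul_left hp.pos h
    · intro c hc
      simp only [coe_filter, mem_range, Set.mem_ofPred_eq] at hc
      have hpc : (p : ℤ) ∣ (c : ℤ) ^ 2 := by
        have h1 : (p : ℤ) ∣ (c : ℤ) ^ 2 - p ^ 2 * D :=
          Dvd.dvd.trans ⟨p * a, by push_cast; ring⟩ hc.2
        have h2 : (p : ℤ) ∣ p ^ 2 * D := ⟨p * D, by ring⟩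
        simpa using dvd_add h1 h2
      have hpc : p ∣ c := by
        exact_mod_cast (Nat.prime_iff_prime_int.1 hp).dvd_of_dvd_pow hpc
      obtain ⟨b, rfl⟩ := hpc
      refine ⟨b, ?_, rfl⟩
      simp only [coe_filter, mem_range, Set.mem_ofPred_eq]
      refine ⟨?_, (key b).1 hc.2⟩
      have := hc.1
      rw [sq, mul_assoc] at this
      exact lt_of_mul_lt_mul_left this hp.pos.le
  · intro x
    rw [← Int.dvd_add_right (a := (a : ℤ)) (b := - (a * (2 * x + a)))]
    · push_cast
      ring_nf
    · exact ⟨-(2 * x + a), by ring⟩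

lemma sqrtCount_prime_of_dvd {p : ℕ} (hp : p.Prime) {D : ℤ} (h : (p : ℤ) ∣ D) :
    sqrtCount p D = 1 := by
  have : Fact p.Prime := ⟨hp⟩
  rw [sqrtCount, (ZMod.intCast_zmod_eq_zero_iff_dvd _ _).2 h, Nat.card_eq_one_iff_unique]
  exact ⟨⟨fun x y => by
    ext
    rw [pow_eq_zero_iff two_ne_zero |>.1 x.2, pow_eq_zero_iff two_ne_zero |>.1 y.2]⟩, ⟨0, by simp⟩⟩

lemma sqrtCount_eq_zero {a : ℕ} (ha : a ≠ 0) {D : ℤ} (h : ∀ b : ℤ, ¬ (a : ℤ) ∣ b ^ 2 - D) :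
    sqrtCount a D = 0 := by
  rw [sqrtCount_eq_card ha, Finset.card_eq_zero, Finset.filter_eq_empty_iff]
  exact fun b _ => h b

lemma sqrtCount_eq_zero_of_exactly_dvd {p : ℕ} (hp : p.Prime) (i : ℕ) {u : ℤ}
    (hu : ¬ (p : ℤ) ∣ u) : sqrtCount (p ^ (i + 2)) (p * u) = 0 := by
  have hp0 := hp.ne_zero
  refine sqrtCount_eq_zero (by positivity) fun b hb => hu ?_
  have hsq : (p : ℤ) * p ∣ b ^ 2 - p * u :=
    Dvd.dvd.trans ⟨p ^ i, by push_cast; ring⟩ hb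
  have h1 : (p : ℤ) ∣ b ^ 2 := by
    simpa using dvd_add ((dvd_mul_right _ _).trans hsq) (dvd_mul_right (p : ℤ) u)
  obtain ⟨c, rfl⟩ := (Nat.prime_iff_prime_int.1 hp).dvd_of_dvd_pow h1
  have h2 : (p : ℤ) * p ∣ p * u := by
    have h3 : (p : ℤ) * p ∣ (p * c) ^ 2 := ⟨c ^ 2, by ring⟩
    simpa using dvd_sub h3 hsq
  exact (mul_dvd_mul_iff_left (by positivity)).1 h2

/-- Modulo `m`, there are exactly two classes `± c` unless `2 * c` vanishes. -/
lemma card_eq_or_eq_neg {m : ℕ} (hm : m ≠ 0) {c : ℤ} (hc : ¬ (m : ℤ) ∣ 2 * c) :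
    (Finset.filter (fun b : ℕ => (m : ℤ) ∣ b - c ∨ (m : ℤ) ∣ b + c) (Finset.range m)).card = 2 := by
  have hm' : (m : ℤ) ≠ 0 := by exact_mod_cast hm
  have hpos : (0 : ℤ) < m := by positivity
  rw [Finset.card_eq_two]
  refine ⟨(c % m).toNat, ((-c) % m).toNat, ?_, ?_⟩
  · intro h
    have h' : c % m = (-c) % m := by
      have := Int.emod_nonneg c hm'
      have := Int.emod_nonneg (-c) hm'
      omega
    refine hc ?_
    have := (Int.emod_emod_of_dvd c (dvd_refl (m : ℤ)))
    have h2 := Int.emod_eq_emod_iff_emod_sub_eq_zero.1 h'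
    have := Int.dvd_of_emod_eq_zero h2
    rwa [sub_neg_eq_add, ← two_mul] at this
  · have key (b : ℕ) (hb : b < m) (x : ℤ) : (m : ℤ) ∣ b - x ↔ b = (x % m).toNat := by
      have h1 := Int.emod_nonneg x hm'
      rw [← Int.emod_eq_emod_iff_emod_sub_eq_zero.trans
        (Int.dvd_iff_emod_eq_zero).symm, Int.emod_eq_of_lt (by positivity) (by exact_mod_cast hb)]
      omega
    have hlt (x : ℤ) : (x % m).toNat < m := by
      have h1 := Int.emod_nonneg x hm'
      have h2 := Int.emod_lt_of_pos x hpos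
      omega
    ext b
    simp only [Finset.mem_filter, Finset.mem_range, Finset.mem_insert, Finset.mem_singleton]
    constructor
    · rintro ⟨hb, h⟩
      rw [key b hb, ← sub_neg_eq_add, key b hb] at h
      exact h
    · intro h
      have hb : b < m := by rcases h with rfl | rfl <;> exact hlt _
      refine ⟨hb, ?_⟩
      rwa [key b hb, ← sub_neg_eq_add, key b hb]

lemma exists_sq_sub_dvd_pow {p : ℕ} (hp : p.Prime) (h2 : p ≠ 2) {u : ℤ} (hu : ¬ (p : ℤ) ∣ u)
    {c : ℤ} (hc : (p : ℤ) ∣ c ^ 2 - u) (i : ℕ) : ∃ b : ℤ, (p : ℤ) ^ (i + 1) ∣ b ^ 2 - u := by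
  induction i with
  | zero => exact ⟨c, by simpa using hc⟩
  | succ i ih =>
    obtain ⟨b, t, ht⟩ := ih
    have hpz := Nat.prime_iff_prime_int.1 hp
    have hcop : IsCoprime (p : ℤ) (2 * b) := by
      refine (Prime.coprime_iff_not_dvd hpz).2 fun h => ?_
      rcases hpz.dvd_or_dvd h with h | h
      · exact h2 ((Nat.prime_dvd_prime_iff_eq hp Nat.prime_two).1 (by exact_mod_cast h))
      · refine hu ?_
        have h3 : (p : ℤ) ∣ b ^ 2 - u := by
          rw [ht, pow_succ]
          exact ⟨p ^ i * t, by ring⟩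
        have := dvd_sub (h.trans (dvd_pow_self b two_ne_zero)) h3
        simpa using this
    obtain ⟨x, y, hxy⟩ := hcop
    refine ⟨b + p ^ (i + 1) * (-t * y), t * x + p ^ i * (t * y) ^ 2, ?_⟩
    have : (b + p ^ (i + 1) * (-t * y)) ^ 2 - u =
      (b ^ 2 - u) - p ^ (i + 1) * t * (y * (2 * b)) + p ^ (i + 1) * p ^ (i + 1) * (t * y) ^ 2 := by
      ring
    rw [this, ht, show y * (2 * b) = 1 - x * p by linarith]
    ring

lemma sqrtCount_odd_prime_pow {p : ℕ} (hp : p.Prime) (h2 : p ≠ 2) {u : ℤ} (hu : ¬ (p : ℤ) ∣ u)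
    (i : ℕ) : (sqrtCount (p ^ (i + 1)) u : ℤ) = 1 + jacobiSym u p := by
  have : Fact p.Prime := ⟨hp⟩
  have hpz := Nat.prime_iff_prime_int.1 hp
  have hp0 := hp.ne_zero
  have hgcd : u.gcd p = 1 := by
    rw [← Int.isCoprime_iff_gcd_eq_one]
    exact ((Prime.coprime_iff_not_dvd hpz).2 hu).symm
  rcases jacobiSym.eq_one_or_neg_one hgcd with h | h
  · obtain ⟨x, hx⟩ := isSquare_iff_exists_sq _ |>.1 (ZMod.isSquare_of_jacobiSym_eq_one h)
    obtain ⟨c, rfl⟩ := ZMod.intCast_surjective x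
    have hc : (p : ℤ) ∣ c ^ 2 - u := by
      rw [← ZMod.intCast_zmod_eq_zero_iff_dvd]
      push_cast
      rw [hx, sub_self]
    obtain ⟨b, hb⟩ := exists_sq_sub_dvd_pow hp h2 hu hc i
    have hpb : ¬ (p : ℤ) ∣ b := fun hpb => hu <| by
      have h3 : (p : ℤ) ∣ b ^ 2 - u := (dvd_pow_self _ (Nat.succ_ne_zero i)).trans hb
      simpa using dvd_sub (hpb.trans (dvd_pow_self b two_ne_zero)) h3
    have hp2b : ¬ (p : ℤ) ∣ 2 * b := fun hd => by
      rcases hpz.dvd_or_dvd hd with hd | hd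
      · exact h2 ((Nat.prime_dvd_prime_iff_eq hp Nat.prime_two).1 (by exact_mod_cast hd))
      · exact hpb hd
    rw [sqrtCount_eq_card (by positivity), h]
    have hcard := card_eq_or_eq_neg (m := p ^ (i + 1)) (by positivity) (c := b) fun hd => hp2b <|
      (dvd_pow_self _ (Nat.succ_ne_zero i)).trans (by exact_mod_cast hd)
    have hiff (z : ℤ) : (p : ℤ) ^ (i + 1) ∣ z ^ 2 - u ↔
        (p : ℤ) ^ (i + 1) ∣ z - b ∨ (p : ℤ) ^ (i + 1) ∣ z + b := by
      have e : z ^ 2 - u = (z - b) * (z + b) + (b ^ 2 - u) := by ring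
      rw [e, dvd_add_left hb]
      constructor
      · intro hz
        by_cases hd : (p : ℤ) ∣ z - b
        · left
          refine IsCoprime.dvd_of_dvd_mul_right (IsCoprime.pow_left ?_) hz
          refine (Prime.coprime_iff_not_dvd hpz).2 fun hd' => hp2b ?_
          have := dvd_sub hd' hd
          ring_nf at this
          rwa [mul_comm]
        · right
          exact IsCoprime.dvd_of_dvd_mul_left
            (IsCoprime.pow_left ((Prime.coprime_iff_not_dvd hpz).2 hd)) hz
      · rintro (hz | hz)
        · exact hz.mul_right _
        · exact hz.mul_left _
    push_cast at hcard ⊢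
    simp only [hiff, hcard]
    norm_num
  · rw [h, sqrtCount_eq_zero (by positivity)]
    · norm_num
    · intro b hb
      refine ZMod.nonsquare_of_jacobiSym_eq_neg_one h ?_
      have h3 : (p : ℤ) ∣ b ^ 2 - u := (dvd_pow_self _ (Nat.succ_ne_zero i)).trans
        (by exact_mod_cast hb)
      rw [← ZMod.intCast_zmod_eq_zero_iff_dvd] at h3
      push_cast at h3
      exact ⟨b, by rw [← sub_eq_zero.1 h3, sq]⟩

lemma exists_sq_sub_dvd_two_pow {u : ℤ} (hu : u % 8 = 1) (i : ℕ) :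
    ∃ b : ℤ, (2 : ℤ) ^ (i + 3) ∣ b ^ 2 - u := by
  induction i with
  | zero => exact ⟨1, by norm_num; omega⟩
  | succ i ih =>
    obtain ⟨b, t, ht⟩ := ih
    have hb : b % 2 = 1 := by
      by_contra h
      have h0 : 2 ∣ b := by omega
      have h1 : 2 ∣ b ^ 2 := h0.trans (dvd_pow_self b two_ne_zero)
      have h2 : b ^ 2 - u = 2 * (2 ^ (i + 2) * t) := by rw [ht]; ring
      omega
    obtain ⟨s, hs⟩ : ∃ s, b = 2 * s + 1 := ⟨b / 2, by omega⟩
    refine ⟨b + 2 ^ (i + 2) * t, t * (s + 1) + 2 ^ i * t ^ 2, ?_⟩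
    have : (b + 2 ^ (i + 2) * t) ^ 2 - u =
        (b ^ 2 - u) + 2 ^ (i + 3) * b * t + 2 ^ (i + 2) * 2 ^ (i + 2) * t ^ 2 := by ring
    rw [this, ht, hs]
    ring

lemma sqrtCount_two_pow {u : ℤ} (hu : u % 2 = 1) (i : ℕ) :
    sqrtCount (2 ^ (i + 3)) u = if u % 8 = 1 then 4 else 0 := by
  split_ifs with h
  · obtain ⟨b, hb⟩ := exists_sq_sub_dvd_two_pow h i
    have hodd : b % 2 = 1 := by
      by_contra h
      have h0 : 2 ∣ b := by omega
      have h1 : 2 ∣ b ^ 2 := h0.trans (dvd_pow_self b two_ne_zero)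
      obtain ⟨t, ht⟩ := hb
      have h2 : b ^ 2 - u = 2 * (2 ^ (i + 2) * t) := by rw [ht]; ring
      omega
    have hiff (z : ℤ) : (2 : ℤ) ^ (i + 3) ∣ z ^ 2 - u ↔
        (2 : ℤ) ^ (i + 2) ∣ z - b ∨ (2 : ℤ) ^ (i + 2) ∣ z + b := by
      have e : z ^ 2 - u = (z - b) * (z + b) + (b ^ 2 - u) := by ring
      rw [e, dvd_add_left hb]
      constructor
      · intro hz
        have hz2 : z % 2 = 1 := by
          by_contra hz2
          have h2 : (2 : ℤ) ∣ (z - b) * (z + b) :=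
            (dvd_pow_self _ (Nat.succ_ne_zero (i + 2))).trans hz
          rcases Int.prime_two.dvd_or_dvd h2 with h2 | h2 <;> omega
        obtain ⟨x, hx⟩ : ∃ x, z - b = 2 * x := ⟨(z - b) / 2, by omega⟩
        obtain ⟨y, hy⟩ : ∃ y, z + b = 2 * y := ⟨(z + b) / 2, by omega⟩
        rw [hx, hy] at hz ⊢
        have hz' : (2 : ℤ) ^ (i + 1) ∣ x * y := by
          rw [← mul_dvd_mul_iff_left (a := (4 : ℤ)) (by norm_num)]
          convert hz using 1 <;> ring
        rw [show (2 : ℤ) ^ (i + 2) = 2 * 2 ^ (i + 1) by ring,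
          mul_dvd_mul_iff_left two_ne_zero, mul_dvd_mul_iff_left two_ne_zero]
        by_cases hd : (2 : ℤ) ∣ x
        · left
          refine IsCoprime.dvd_of_dvd_mul_right (IsCoprime.pow_left ?_) hz'
          exact (Prime.coprime_iff_not_dvd Int.prime_two).2 fun hd' => by omega
        · right
          exact IsCoprime.dvd_of_dvd_mul_left
            (IsCoprime.pow_left ((Prime.coprime_iff_not_dvd Int.prime_two).2 hd)) hz'
      · have aux {x y : ℤ} (hx : (2 : ℤ) ^ (i + 2) ∣ x) (hy : 2 ∣ y) :
            (2 : ℤ) ^ (i + 3) ∣ x * y := by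
          rw [pow_succ]
          exact mul_dvd_mul hx hy
        have two_dvd {x : ℤ} (hx : (2 : ℤ) ^ (i + 2) ∣ x) : 2 ∣ x :=
          (dvd_pow_self _ (Nat.succ_ne_zero (i + 1))).trans hx
        rintro (hz | hz)
        · have := two_dvd hz
          exact aux hz (by omega)
        · have := two_dvd hz
          rw [mul_comm]
          exact aux hz (by omega)
    rw [sqrtCount_eq_card (by positivity)]
    have hcard := card_eq_or_eq_neg (m := 2 ^ (i + 2)) (by positivity) (c := b) fun hd => by
      have h4 : (4 : ℤ) ∣ 2 * b := Dvd.dvd.trans ⟨2 ^ i, by push_cast; ring⟩ hd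
      omega
    push_cast at hcard ⊢
    simp only [hiff]
    rw [show 2 ^ (i + 3) = 2 * 2 ^ (i + 2) by ring, card_filter_range_mul _ (2 ^ (i + 2)) 2, hcard]
    intro x
    push_cast
    rw [show (x + 2 ^ (i + 2) : ℤ) - b = (x - b) + 2 ^ (i + 2) by ring,
      show (x + 2 ^ (i + 2) : ℤ) + b = (x + b) + 2 ^ (i + 2) by ring,
      dvd_add_self_right, dvd_add_self_right]
  · refine sqrtCount_eq_zero (by positivity) fun b hb => h ?_
    have h8 : (8 : ℤ) ∣ b ^ 2 - u := Dvd.dvd.trans ⟨2 ^ i, by push_cast; ring⟩ hb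
    have hb2 : b ^ 2 % 8 = 0 ∨ b ^ 2 % 8 = 1 ∨ b ^ 2 % 8 = 4 := by
      have : b % 8 = 0 ∨ b % 8 = 1 ∨ b % 8 = 2 ∨ b % 8 = 3 ∨ b % 8 = 4 ∨ b % 8 = 5 ∨ b % 8 = 6 ∨
        b % 8 = 7 := by omega
      rcases this with h | h | h | h | h | h | h | h <;> simp [sq, Int.mul_emod, h]
    omega

open Finset in
lemma sum_antidiagonal_prime_pow {p : ℕ} (hp : p.Prime) (h2 : p ≠ 2) (k : ℕ) :
    ∃ α β : ℕ, ∀ u : ℤ, ¬ (p : ℤ) ∣ u → ∀ G : ℕ → ℤ, (∀ j, G (j + 2) = G j) →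
      ∑ x ∈ antidiagonal k, (sqrtCount (p ^ x.1) (p ^ x.2 * u) : ℤ) * G x.2 =
        α * G 0 + β * (jacobiSym u p * G 0 + G 1) := by
  have hpd (j : ℕ) (u : ℤ) : sqrtCount (p ^ 1) (p ^ (j + 1) * u) = 1 := by
    rw [pow_one]
    exact sqrtCount_prime_of_dvd hp ⟨p ^ j * u, by ring⟩
  induction k using Nat.strong_induction_on with
  | _ k ih =>
    match k with
    | 0 =>
      refine ⟨1, 0, fun u hu G hG => ?_⟩
      simp [sqrtCount_one]
    | 1 =>
      refine ⟨1, 1, fun u hu G hG => ?_⟩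
      have := sqrtCount_odd_prime_pow hp h2 hu 0
      simp only [Nat.sum_antidiagonal_succ, Nat.antidiagonal_zero, sum_singleton]
      simp only [pow_zero, sqrtCount_one, one_mul, this]
      push_cast
      ring
    | 2 =>
      refine ⟨2, 1, fun u hu G hG => ?_⟩
      have := sqrtCount_odd_prime_pow hp h2 hu 1
      simp only [Nat.sum_antidiagonal_succ, Nat.antidiagonal_zero, sum_singleton]
      simp only [pow_zero, sqrtCount_one, one_mul, zero_add, hpd, this, hG]
      push_cast
      ring
    | 3 =>
      refine ⟨2, 1, fun u hu G hG => ?_⟩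
      have := sqrtCount_odd_prime_pow hp h2 hu 2
      have h0 := sqrtCount_eq_zero_of_exactly_dvd hp 0 hu
      simp only [Nat.sum_antidiagonal_succ, Nat.antidiagonal_zero, sum_singleton]
      simp only [pow_zero, sqrtCount_one, one_mul, zero_add, hpd, this, hG 0, hG 1]
      simp only [zero_add, pow_one, Nat.reduceAdd] at h0 ⊢
      rw [h0]
      push_cast
      ring
    | k + 4 =>
      obtain ⟨α, β, h⟩ := ih k (by omega)
      refine ⟨p * α + 2, p * β + 1, fun u hu G hG => ?_⟩
      have h1 := sqrtCount_odd_prime_pow hp h2 hu (k + 3)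
      have h0 : sqrtCount (p ^ (k + 3)) (p ^ 1 * u) = 0 := by
        rw [pow_one, sqrtCount_eq_zero_of_exactly_dvd hp (k + 1) hu]
      have hstep (i j : ℕ) : sqrtCount (p ^ (i + 1 + 1)) (p ^ (j + 1 + 1) * u) =
          p * sqrtCount (p ^ i) (p ^ j * u) := by
        rw [← sqrtCount_prime_sq_mul hp (pow_ne_zero _ hp.ne_zero)]
        ring_nf
      have hGk : G k + G (k + 1) = G 0 + G 1 := by
        clear h h1 h0 ih
        induction k with
        | zero => rfl
        | succ k ih => rw [hG, add_comm, ih]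
      rw [Nat.sum_antidiagonal_succ, Nat.sum_antidiagonal_succ, Nat.sum_antidiagonal_succ',
        Nat.sum_antidiagonal_succ']
      have h := h u hu G hG
      simp only [hstep, pow_zero, sqrtCount_one, one_mul, zero_add, hpd, h1, hG (k + 2), hG (k + 1),
        hG k, h0, hG, Nat.cast_mul, mul_assoc, ← mul_sum, h,
        show k + 1 + 1 + 1 = k + 3 by rfl]
      push_cast
      linear_combination hGk

lemma prime_pow_mul_inj {p : ℕ} (hp : p.Prime) {i j a b : ℕ} (ha : ¬ p ∣ a) (hb : ¬ p ∣ b)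
    (h : p ^ i * a = p ^ j * b) : i = j ∧ a = b := by
  have aux {i j a b : ℕ} (ha : ¬ p ∣ a) (h : p ^ i * a = p ^ j * b) : j ≤ i := by
    have h1 : p ^ j ∣ p ^ i * a := ⟨b, h⟩
    have h2 := (Nat.Coprime.pow_left j ((Nat.Prime.coprime_iff_not_dvd hp).2 ha)).dvd_of_dvd_mul_right
      h1
    exact (Nat.pow_dvd_pow_iff_le_right hp.one_lt).1 h2
  obtain rfl : i = j := le_antisymm (aux hb h.symm) (aux ha h)
  exact ⟨rfl, Nat.eq_of_mul_eq_mul_left (pow_pos hp.pos _) h⟩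

open Finset in
lemma sum_divisorsAntidiagonal_prime_pow_mul {p : ℕ} (hp : p.Prime) {m : ℕ} (hm : ¬ p ∣ m) (k : ℕ)
    (f : ℕ → ℕ → ℤ) :
    ∑ x ∈ (p ^ k * m).divisorsAntidiagonal, f x.1 x.2 =
      ∑ y ∈ antidiagonal k, ∑ x ∈ m.divisorsAntidiagonal,
        f (p ^ y.1 * x.1) (p ^ y.2 * x.2) := by
  have hm0 : m ≠ 0 := by rintro rfl; simp at hm
  rw [← sum_product']
  symm
  refine sum_nbij (fun z => (p ^ z.1.1 * z.2.1, p ^ z.1.2 * z.2.2)) ?_ ?_ ?_ ?_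
  · rintro ⟨⟨i, j⟩, a, b⟩ h
    simp only [mem_product, HasAntidiagonal.mem_antidiagonal, Nat.mem_divisorsAntidiagonal] at h ⊢
    obtain ⟨rfl, rfl, -⟩ := h
    refine ⟨by ring, mul_ne_zero (pow_ne_zero _ hp.ne_zero) hm0⟩
  · rintro ⟨⟨i, j⟩, a, b⟩ h ⟨⟨i', j'⟩, a', b'⟩ h' e
    simp only [coe_product, Set.mem_prod, mem_coe, HasAntidiagonal.mem_antidiagonal,
      Nat.mem_divisorsAntidiagonal, Prod.mk.injEq] at h h' e
    obtain ⟨-, h, -⟩ := h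
    obtain ⟨-, h', -⟩ := h'
    obtain ⟨rfl, rfl⟩ := prime_pow_mul_inj hp (fun hd => hm (h ▸ hd.mul_right _))
      (fun hd => hm (h' ▸ hd.mul_right _)) e.1
    obtain ⟨rfl, rfl⟩ := prime_pow_mul_inj hp (fun hd => hm (h ▸ hd.mul_left _))
      (fun hd => hm (h' ▸ hd.mul_left _)) e.2
    rfl
  · rintro ⟨A, B⟩ h
    simp only [mem_coe, Nat.mem_divisorsAntidiagonal] at h
    obtain ⟨h, h0⟩ := h
    have hA : A ≠ 0 := by rintro rfl; simp [← h] at h0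
    have hB : B ≠ 0 := by rintro rfl; simp [← h] at h0
    obtain ⟨i, a, ha, rfl⟩ := Nat.exists_eq_pow_mul_and_not_dvd hA p hp.ne_one
    obtain ⟨j, b, hb, rfl⟩ := Nat.exists_eq_pow_mul_and_not_dvd hB p hp.ne_one
    have hab : ¬ p ∣ a * b := fun hd => (hp.dvd_mul.1 hd).elim ha hb
    obtain ⟨h1, h2⟩ := prime_pow_mul_inj hp (i := i + j) (j := k) hab hm (by rw [← h]; ring)
    exact ⟨((i, j), (a, b)), by simp [h1, h2, hm0], rfl⟩
  · intro z _
    rfl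

/-- For odd `m`, weighted sums over the factorizations `a * D = m` of the number of square roots of
`s * D` modulo `a` are sums of Jacobi symbols over a multiset of pairs that is symmetric under
swapping. -/
lemma exists_symmetric_jacobiSym_sum {m : ℕ} (hm : Odd m) :
    ∃ L : Multiset (ℕ × ℕ), L.map Prod.swap = L ∧ (∀ x ∈ L, x.1 ∣ m ∧ x.2 ∣ m) ∧
      ∀ s : ℤ, s.gcd m = 1 → ∀ φ : ℕ → ℤ, (∀ x y, y ∣ m → φ (x * y ^ 2) = φ x) →
        ∑ x ∈ m.divisorsAntidiagonal, (sqrtCount x.1 (s * x.2) : ℤ) * φ x.2 =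
          (L.map fun x => jacobiSym x.1 x.2 * jacobiSym s x.2 * φ x.1).sum := by
  induction m using Nat.recOnPrimePow with
  | zero => simp at hm
  | one =>
    exact ⟨{(1, 1)}, by simp, by simp, fun s _ φ _ => by simp [sqrtCount_one]⟩
  | prime_pow_mul m p k hp hpm hk ih =>
    obtain ⟨L, hswap, hdvd, hL⟩ := ih (Nat.odd_mul.1 hm).2
    have hm0 : m ≠ 0 := by rintro rfl; simp at hpm
    have h2 : p ≠ 2 := by
      rintro rfl
      exact (Nat.not_odd_iff_even.2 ((even_two.pow_of_ne_zero hk.ne').mul_right m)) hm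
    obtain ⟨α, β, hloc⟩ := sum_antidiagonal_prime_pow hp h2 k
    refine ⟨α • L + β • (L.map (fun x => (x.1, p * x.2)) + L.map (fun x => (p * x.1, x.2))),
      ?_, ?_, ?_⟩
    · have aux : L.map (fun x => (p * x.2, x.1)) = L.map (fun x => (p * x.1, x.2)) := by
        conv_rhs => rw [← hswap, Multiset.map_map]
        rfl
      have aux' : L.map (fun x => (x.2, p * x.1)) = L.map (fun x => (x.1, p * x.2)) := by
        conv_rhs => rw [← hswap, Multiset.map_map]
        rfl
      simp only [Multiset.map_add, Multiset.map_nsmul, Multiset.map_map, hswap]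
      congr 2
      rw [add_comm]
      exact congrArg₂ _ aux' aux
    · have hpk : p ∣ p ^ k := dvd_pow_self p hk.ne'
      have key (x : ℕ × ℕ) (hx : x ∈ L) : (x.1 ∣ p ^ k * m ∧ x.2 ∣ p ^ k * m) ∧
          p * x.1 ∣ p ^ k * m ∧ p * x.2 ∣ p ^ k * m :=
        ⟨⟨(hdvd x hx).1.mul_left _, (hdvd x hx).2.mul_left _⟩,
          mul_dvd_mul hpk (hdvd x hx).1, mul_dvd_mul hpk (hdvd x hx).2⟩
      intro x hx
      rw [Multiset.mem_add] at hx
      rcases hx with hx | hx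
      · exact (key x (Multiset.mem_of_mem_nsmul hx)).1
      · rcases Multiset.mem_add.1 (Multiset.mem_of_mem_nsmul hx) with hx | hx
        · obtain ⟨y, hy, rfl⟩ := Multiset.mem_map.1 hx
          exact ⟨(key y hy).1.1, (key y hy).2.2⟩
        · obtain ⟨y, hy, rfl⟩ := Multiset.mem_map.1 hx
          exact ⟨(key y hy).2.1, (key y hy).1.2⟩
    · intro s hs φ hφ
      have hpz := Nat.prime_iff_prime_int.1 hp
      have hcop : p.Coprime m := (Nat.Prime.coprime_iff_not_dvd hp).2 hpm
      rw [← Int.isCoprime_iff_gcd_eq_one, Nat.cast_mul, Nat.cast_pow,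
        IsCoprime.mul_right_iff, IsCoprime.pow_right_iff hk] at hs
      obtain ⟨hsp, hsm⟩ := hs
      have hφp (x : ℕ) : φ (x * p ^ 2) = φ x := hφ x p ((dvd_pow_self p hk.ne').mul_right m)
      rw [sum_divisorsAntidiagonal_prime_pow_mul hp hpm k
        fun a D => (sqrtCount a (s * D) : ℤ) * φ D]
      have hinner (y : ℕ × ℕ) : ∑ x ∈ m.divisorsAntidiagonal,
          (sqrtCount (p ^ y.1 * x.1) (s * (p ^ y.2 * x.2 : ℕ)) : ℤ) * φ (p ^ y.2 * x.2) =
          (L.map fun x => jacobiSym x.1 x.2 * jacobiSym (s * p ^ y.2) x.2 *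
            (sqrtCount (p ^ y.1) (p ^ y.2 * (s * x.1)) * φ (p ^ y.2 * x.1))).sum := by
        rw [← hL (s * p ^ y.2) _
          (fun D => sqrtCount (p ^ y.1) (p ^ y.2 * (s * D)) * φ (p ^ y.2 * D))]
        · refine Finset.sum_congr rfl fun x hx => ?_
          have hx := (Nat.mem_divisorsAntidiagonal.1 hx).1
          rw [sqrtCount_mul]
          · push_cast
            rw [show s * ((p : ℤ) ^ y.2 * x.2) = p ^ y.2 * (s * x.2) by ring,
              show s * (p : ℤ) ^ y.2 * x.2 = p ^ y.2 * (s * x.2) by ring]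
            ring
          · exact Nat.Coprime.pow_left _ (hcop.coprime_dvd_right ⟨_, hx.symm⟩)
        · intro x y' hy'
          rw [← hφ (p ^ y.2 * x) y' (hy'.mul_left _), ← mul_assoc,
            ← sqrtCount_mul_sq ((hcop.coprime_dvd_right hy').symm.pow_right y.1)
              (p ^ y.2 * (s * x))]
          push_cast
          ring_nf
        · rw [← Int.isCoprime_iff_gcd_eq_one]
          exact hsm.mul_left (IsCoprime.pow_left (Nat.isCoprime_iff_coprime.2 hcop))
      simp only [hinner]
      have hexch := Multiset.sum_map_sum_map (Finset.HasAntidiagonal.antidiagonal k).val L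
        (f := fun y x => jacobiSym x.1 x.2 * jacobiSym (s * p ^ y.2) x.2 *
            (sqrtCount (p ^ y.1) (p ^ y.2 * (s * x.1)) * φ (p ^ y.2 * x.1)))
      refine hexch.trans ?_
      simp only [Multiset.map_add, Multiset.map_nsmul, Multiset.map_map, Multiset.sum_add,
        Multiset.sum_nsmul, ← Multiset.sum_map_add, ← Multiset.sum_map_nsmul]
      refine congrArg _ (Multiset.map_congr rfl fun x hx => ?_)
      obtain ⟨hx1, hx2⟩ := hdvd x hx
      have hx20 : x.2 ≠ 0 := ne_zero_of_dvd_ne_zero hm0 hx2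
      have hpx1 : ¬ (p : ℤ) ∣ s * x.1 := fun hd => by
        rcases hpz.dvd_or_dvd hd with hd | hd
        · exact hpz.not_isUnit (hsp.isUnit_of_dvd' hd dvd_rfl)
        · exact hpm ((Int.natCast_dvd_natCast.1 hd).trans hx1)
      have hJp : jacobiSym p x.2 ^ 2 = 1 :=
        jacobiSym.sq_one (by simpa using hcop.coprime_dvd_right hx2)
      have := hloc (s * x.1) hpx1
        (fun j => jacobiSym x.1 x.2 * jacobiSym (s * p ^ j) x.2 * φ (p ^ j * x.1)) fun j => by
          rw [← hφp (p ^ j * x.1), jacobiSym.mul_left, jacobiSym.mul_left, jacobiSym.pow_left,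
            jacobiSym.pow_left, pow_add, hJp]
          ring_nf
      have hgoal : ((Finset.HasAntidiagonal.antidiagonal k).val.map fun y : ℕ × ℕ =>
          jacobiSym x.1 x.2 * jacobiSym (s * p ^ y.2) x.2 *
            (sqrtCount (p ^ y.1) (p ^ y.2 * (s * x.1)) * φ (p ^ y.2 * x.1))).sum =
          ∑ y ∈ Finset.HasAntidiagonal.antidiagonal k, (sqrtCount (p ^ y.1) (p ^ y.2 * (s * x.1)) : ℤ) *
            (jacobiSym x.1 x.2 * jacobiSym (s * p ^ y.2) x.2 * φ (p ^ y.2 * x.1)) := by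
        refine Finset.sum_congr rfl fun y _ => ?_
        ring
      rw [hgoal, this]
      simp only [pow_zero, mul_one, one_mul, pow_one, jacobiSym.mul_left, Function.comp_apply,
        jacobiSym.mul_right' _ hp.ne_zero hx20, Nat.cast_mul, nsmul_eq_mul]
      ring

lemma sqrtCount_two (D : ℤ) : sqrtCount 2 D = 1 := by
  rcases Int.emod_two_eq_zero_or_one D with h | h
  · exact sqrtCount_prime_of_dvd Nat.prime_two (Int.dvd_of_emod_eq_zero h)
  · rw [sqrtCount_congr (D' := 1) (by push_cast; omega), sqrtCount_eq_card two_ne_zero]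
    decide

lemma sqrtCount_four {v : ℤ} (hv : v % 2 = 1) :
    sqrtCount 4 v = if v % 4 = 1 then 2 else 0 := by
  split_ifs with h
  · rw [sqrtCount_congr (D' := 1) (by push_cast; omega), sqrtCount_eq_card four_ne_zero]
    decide
  · rw [sqrtCount_congr (D' := 3) (by push_cast; omega), sqrtCount_eq_card four_ne_zero]
    decide

lemma sqrtCount_two_pow_two_mul {v : ℤ} (hv : v % 2 = 1) (i : ℕ) :
    sqrtCount (2 ^ (i + 2)) (2 * v) = 0 :=
  sqrtCount_eq_zero_of_exactly_dvd Nat.prime_two i (by push_cast; omega)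

lemma sqrtCount_two_pow_step (i j : ℕ) (v : ℤ) : sqrtCount (2 ^ (i + 2)) (2 ^ (j + 2) * v) =
    2 * sqrtCount (2 ^ i) (2 ^ j * v) := by
  rw [← sqrtCount_prime_sq_mul Nat.prime_two (by positivity)]
  push_cast
  ring_nf

open Finset HasAntidiagonal in
lemma sum_antidiagonal_two_pow {v : ℤ} (hv : v % 2 = 1) {X : ℤ} (hX : X ^ 2 = 1) :
    let S : ℕ → ℤ := fun k => ∑ y ∈ antidiagonal k, (sqrtCount (2 ^ y.1) (2 ^ y.2 * v) : ℤ) * X ^ y.2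
    S 0 = 1 ∧ S 1 = 1 + X ∧ S 2 = 1 + X + (if v % 4 = 1 then 2 else 0) ∧
      S 3 = 1 + X + (if v % 8 = 1 then 4 else 0) ∧
      ∀ k, S (k + 4) = 2 * S k + 1 + X + (if v % 8 = 1 then 4 else 0) := by
  intro S
  have hX3 : X ^ 3 = X := by rw [pow_succ, hX, one_mul]
  have h4 := sqrtCount_four hv
  have h8 := sqrtCount_two_pow hv 0
  have h0 := sqrtCount_two_pow_two_mul hv 0
  norm_num at h8 h0
  refine ⟨?_, ?_, ?_, ?_, fun k => ?_⟩
  · simp [S, sqrtCount_one]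
  · simp [S, Nat.sum_antidiagonal_succ, sqrtCount_one, sqrtCount_two]
    ring
  · simp [S, Nat.sum_antidiagonal_succ, sqrtCount_one, sqrtCount_two, h4, hX]
    ring
  · simp [S, Nat.sum_antidiagonal_succ, sqrtCount_one, sqrtCount_two, h8, h0, hX, hX3]
    ring
  · have hXk : X ^ (k + 4) + X ^ (k + 3) = 1 + X := by
      induction k with
      | zero => linear_combination (X ^ 2 + 1 + X) * hX
      | succ k ih => linear_combination ih + X ^ (k + 3) * hX
    have h8 := sqrtCount_two_pow hv (k + 1)
    have h0 : sqrtCount (2 ^ (k + 1 + 2)) (2 ^ 1 * v) = 0 := by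
      rw [pow_one, sqrtCount_two_pow_two_mul hv (k + 1)]
    have hstep (i j : ℕ) : sqrtCount (2 ^ (i + 1 + 1)) (2 ^ (j + 1 + 1) * v) =
      2 * sqrtCount (2 ^ i) (2 ^ j * v) := sqrtCount_two_pow_step i j v
    have hmid : ∑ y ∈ antidiagonal k, (2 * (sqrtCount (2 ^ y.1) (2 ^ y.2 * v) : ℤ)) * X ^ (y.2 + 1 + 1)
        = 2 * S k := by
      simp only [S, mul_sum]
      refine sum_congr rfl fun y _ => ?_
      linear_combination 2 * (sqrtCount (2 ^ y.1) (2 ^ y.2 * v) : ℤ) * X ^ y.2 * hX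
    simp only [S] at hmid ⊢
    rw [Nat.sum_antidiagonal_succ, Nat.sum_antidiagonal_succ, Nat.sum_antidiagonal_succ',
      Nat.sum_antidiagonal_succ']
    simp only [hstep, Nat.cast_mul, Nat.cast_ofNat, hmid, zero_add, pow_zero, one_mul, h0,
      h8, sqrtCount_one, show k + 1 + 1 + 1 = k + 3 by rfl]
    rw [pow_one, sqrtCount_two]
    push_cast
    linear_combination hXk

open Finset HasAntidiagonal in
lemma sum_antidiagonal_four_mul_two_pow {v : ℤ} (hv : v % 2 = 1) {X : ℤ} (hX : X ^ 2 = 1) :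
    let T : ℕ → ℤ := fun k =>
      ∑ y ∈ antidiagonal k, (sqrtCount (2 ^ (y.1 + 2)) (2 ^ y.2 * v) : ℤ) * X ^ y.2
    T 0 = (if v % 4 = 1 then 2 else 0) ∧ T 1 = (if v % 8 = 1 then 4 else 0) ∧
      T 2 = 2 + (if v % 8 = 1 then 4 else 0) ∧
      T 3 = 2 + 2 * X + (if v % 8 = 1 then 4 else 0) ∧
      ∀ k, T (k + 4) = 2 * T k + 2 + 2 * X + (if v % 8 = 1 then 4 else 0) := by
  intro T
  have hX3 : X ^ 3 = X := by rw [pow_succ, hX, one_mul]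
  have h4 := sqrtCount_four hv
  have h8 := sqrtCount_two_pow hv
  have h0 := sqrtCount_two_pow_two_mul hv
  have h4' (j : ℕ) : sqrtCount 4 (2 ^ (j + 2) * v) = 2 := by
    simpa [sqrtCount_one] using sqrtCount_two_pow_step 0 j v
  have h8' (j : ℕ) : sqrtCount 8 (2 ^ (j + 2) * v) = 2 := by
    simpa [sqrtCount_two] using sqrtCount_two_pow_step 1 j v
  refine ⟨?_, ?_, ?_, ?_, fun k => ?_⟩
  · simp [T, h4]
  · have := h8 0
    have := h0 0
    norm_num at *
    simp [T, Nat.sum_antidiagonal_succ, *]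
  · have := h8 1
    have := h0 1
    have := h4' 0
    norm_num at *
    simp [T, Nat.sum_antidiagonal_succ, *]
  · have h8 := h8 2
    have h0 := h0 2
    have h4' := h4' 1
    have h8' := h8' 0
    norm_num at h8 h0 h4' h8'
    simp [T, Nat.sum_antidiagonal_succ, h8, h0, h4', h8', hX, hX3]
    ring
  · have hXk : X ^ (k + 4) + X ^ (k + 3) = 1 + X := by
      induction k with
      | zero => linear_combination (X ^ 2 + 1 + X) * hX
      | succ k ih => linear_combination ih + X ^ (k + 3) * hX
    have h8 := h8 (k + 3)
    have h0 : sqrtCount (2 ^ (k + 1 + 2 + 2)) (2 ^ 1 * v) = 0 := by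
      rw [pow_one, h0]
    have hstep (i j : ℕ) : sqrtCount (2 ^ (i + 1 + 1 + 2)) (2 ^ (j + 1 + 1) * v) =
      2 * sqrtCount (2 ^ (i + 2)) (2 ^ j * v) := sqrtCount_two_pow_step (i + 2) j v
    have hmid : ∑ y ∈ antidiagonal k,
        (2 * (sqrtCount (2 ^ (y.1 + 2)) (2 ^ y.2 * v) : ℤ)) * X ^ (y.2 + 1 + 1) = 2 * T k := by
      simp only [T, mul_sum]
      refine sum_congr rfl fun y _ => ?_
      linear_combination 2 * (sqrtCount (2 ^ (y.1 + 2)) (2 ^ y.2 * v) : ℤ) * X ^ y.2 * hX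
    simp only [T] at hmid ⊢
    rw [Nat.sum_antidiagonal_succ, Nat.sum_antidiagonal_succ, Nat.sum_antidiagonal_succ',
      Nat.sum_antidiagonal_succ']
    have e4 := h4' (k + 2)
    have e8 := h8' (k + 1)
    simp only [show k + 2 + 2 = k + 4 by rfl, show k + 1 + 2 = k + 3 by rfl] at e4 e8 h0
    simp only [hstep, Nat.cast_mul, Nat.cast_ofNat, hmid, zero_add, pow_zero, one_mul, h0,
      h8, show k + 1 + 1 + 1 = k + 3 by rfl, show k + 1 + 1 + 2 = k + 4 by rfl,
      Nat.reduceAdd, show (2 : ℕ) ^ 2 = 4 by rfl,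
      show (2 : ℕ) ^ 3 = 8 by rfl, e4, e8, show k + 4 + 2 = k + 3 + 3 by rfl]
    push_cast
    linear_combination 2 * hXk

open Finset HasAntidiagonal in
/-- The local symmetry at the prime `2`. -/
lemma jacobiSym_mul_sum_antidiagonal_two_pow {d e : ℕ} (hd : Odd d) (he : Odd e) (k : ℕ) :
    jacobiSym d e *
      ((∑ y ∈ antidiagonal k, (sqrtCount (2 ^ (y.1 + 2)) (2 ^ y.2 * d) : ℤ) * jacobiSym 2 e ^ y.2) +
        jacobiSym (-1) e * ∑ y ∈ antidiagonal k,
          (sqrtCount (2 ^ (y.1 + 2)) (2 ^ y.2 * -d) : ℤ) * jacobiSym 2 e ^ y.2) =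
    jacobiSym e d * (2 * ∑ y ∈ antidiagonal k,
      (sqrtCount (2 ^ y.1) (2 ^ y.2 * e) : ℤ) * jacobiSym 2 d ^ y.2) := by
  have hd2 := Nat.odd_iff.1 hd
  have he2 := Nat.odd_iff.1 he
  have hX2 : jacobiSym 2 e ^ 2 = 1 := jacobiSym.sq_one he.coprime_two_left
  have hY2 : jacobiSym 2 d ^ 2 = 1 := jacobiSym.sq_one hd.coprime_two_left
  obtain ⟨S0, S1, S2, S3, S4⟩ := sum_antidiagonal_two_pow (v := e) (by omega) hY2
  obtain ⟨T0, T1, T2, T3, T4⟩ := sum_antidiagonal_four_mul_two_pow (v := d) (by omega) hX2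
  obtain ⟨U0, U1, U2, U3, U4⟩ := sum_antidiagonal_four_mul_two_pow (v := -d) (by omega) hX2
  have hrec := jacobiSym.quadratic_reciprocity_if hd2 he2
  have hX := (jacobiSym.at_two he).trans (ZMod.χ₈_nat_eq_if_mod_eight e)
  have hY := (jacobiSym.at_two hd).trans (ZMod.χ₈_nat_eq_if_mod_eight d)
  have hψ := (jacobiSym.at_neg_one he).trans (ZMod.χ₄_nat_eq_if_mod_four e)
  set S : ℕ → ℤ := fun k => ∑ y ∈ antidiagonal k,
    (sqrtCount (2 ^ y.1) (2 ^ y.2 * e) : ℤ) * jacobiSym 2 d ^ y.2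
  set T : ℕ → ℤ := fun k => ∑ y ∈ antidiagonal k,
    (sqrtCount (2 ^ (y.1 + 2)) (2 ^ y.2 * d) : ℤ) * jacobiSym 2 e ^ y.2
  set U : ℕ → ℤ := fun k => ∑ y ∈ antidiagonal k,
    (sqrtCount (2 ^ (y.1 + 2)) (2 ^ y.2 * -d) : ℤ) * jacobiSym 2 e ^ y.2
  change jacobiSym d e * (T k + jacobiSym (-1) e * U k) = jacobiSym e d * (2 * S k)
  clear_value S T U
  suffices h : T k + jacobiSym (-1) e * U k =
      (if d % 4 = 3 ∧ e % 4 = 3 then -1 else 1) * (2 * S k) by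
    rw [h, ← hrec]
    split_ifs <;> ring
  rw [hX] at T3 T4 U3 U4
  rw [hY] at S1 S2 S3 S4
  rw [hψ]
  clear hX hY hψ hX2 hY2 hrec
  have hd8 : d % 8 = 1 ∨ d % 8 = 3 ∨ d % 8 = 5 ∨ d % 8 = 7 := by omega
  have he8 : e % 8 = 1 ∨ e % 8 = 3 ∨ e % 8 = 5 ∨ e % 8 = 7 := by omega
  have hd4 : d % 4 = d % 8 % 4 := by omega
  have he4 : e % 4 = e % 8 % 4 := by omega
  have hdz4 : (d : ℤ) % 4 = (d % 8 : ℕ) % 4 := by omega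
  have hdz8 : (d : ℤ) % 8 = (d % 8 : ℕ) := by omega
  have hdn4 : -(d : ℤ) % 4 = -(d % 8 : ℕ) % 4 := by omega
  have hdn8 : -(d : ℤ) % 8 = -(d % 8 : ℕ) % 8 := by omega
  have hez4 : (e : ℤ) % 4 = (e % 8 : ℕ) % 4 := by omega
  have hez8 : (e : ℤ) % 8 = (e % 8 : ℕ) := by omega
  rw [hdz4] at T0
  rw [hdz8] at T1 T2 T3 T4
  rw [hdn4] at U0
  rw [hdn8] at U1 U2 U3 U4
  rw [hez4] at S2
  rw [hez8] at S3 S4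
  rw [he4, hd4]
  clear hd4 he4 hdz4 hdz8 hdn4 hdn8 hez4 hez8
  induction k using Nat.strong_induction_on with
  | _ k ih =>
    match k with
    | 0 =>
      rcases hd8 with h | h | h | h <;> rcases he8 with h' | h' | h' | h' <;>
        simp [h, h', he2, T0, U0, S0]
    | 1 =>
      rcases hd8 with h | h | h | h <;> rcases he8 with h' | h' | h' | h' <;>
        simp [h, h', hd2, he2, T1, U1, S1]
    | 2 =>
      rcases hd8 with h | h | h | h <;> rcases he8 with h' | h' | h' | h' <;>
        simp [h, h', hd2, he2, T2, U2, S2]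
    | 3 =>
      rcases hd8 with h | h | h | h <;> rcases he8 with h' | h' | h' | h' <;>
        simp [h, h', hd2, he2, T3, U3, S3]
    | k + 4 =>
      have ih := ih k (by omega)
      rw [T4, U4, S4]
      clear T4 U4 S4
      rcases hd8 with h | h | h | h <;> rcases he8 with h' | h' | h' | h' <;>
        simp [h, h', hd2, he2] at ih ⊢ <;> linarith

open Finset HasAntidiagonal in
lemma sum_divisorsAntidiagonal_sqrtCount {m : ℕ} (hm : Odd m) {L : Multiset (ℕ × ℕ)}
    (hL : ∀ s : ℤ, s.gcd m = 1 → ∀ φ : ℕ → ℤ, (∀ x y, y ∣ m → φ (x * y ^ 2) = φ x) →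
      ∑ x ∈ m.divisorsAntidiagonal, (sqrtCount x.1 (s * x.2) : ℤ) * φ x.2 =
        (L.map fun x => jacobiSym x.1 x.2 * jacobiSym s x.2 * φ x.1).sum)
    (k r : ℕ) {u : ℤ} (hu : IsUnit u) :
    ∑ x ∈ (2 ^ k * m).divisorsAntidiagonal, (sqrtCount (2 ^ r * x.1) (u * x.2) : ℤ) =
      (L.map fun x => jacobiSym x.1 x.2 * (jacobiSym u x.2 * ∑ y ∈ antidiagonal k,
        (sqrtCount (2 ^ (y.1 + r)) (2 ^ y.2 * (u * x.1)) : ℤ) * jacobiSym 2 x.2 ^ y.2)).sum := by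
  have hcop : Nat.Coprime 2 m := hm.coprime_two_left
  rw [sum_divisorsAntidiagonal_prime_pow_mul Nat.prime_two hm.not_two_dvd_nat k
    fun a D => (sqrtCount (2 ^ r * a) (u * D) : ℤ)]
  have hinner (y : ℕ × ℕ) : ∑ x ∈ m.divisorsAntidiagonal,
      (sqrtCount (2 ^ r * (2 ^ y.1 * x.1)) (u * (2 ^ y.2 * x.2 : ℕ)) : ℤ) =
      (L.map fun x => jacobiSym x.1 x.2 * jacobiSym (u * 2 ^ y.2) x.2 *
        (sqrtCount (2 ^ (y.1 + r)) (2 ^ y.2 * (u * x.1)) : ℤ)).sum := by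
    rw [← hL (u * 2 ^ y.2) _ fun D => (sqrtCount (2 ^ (y.1 + r)) (2 ^ y.2 * (u * D)) : ℤ)]
    · refine sum_congr rfl fun x hx => ?_
      have hx := (Nat.mem_divisorsAntidiagonal.1 hx).1
      rw [show 2 ^ r * (2 ^ y.1 * x.1) = 2 ^ (y.1 + r) * x.1 by ring, sqrtCount_mul]
      · push_cast
        rw [show u * ((2 : ℤ) ^ y.2 * x.2) = 2 ^ y.2 * (u * x.2) by ring,
          show u * (2 : ℤ) ^ y.2 * x.2 = 2 ^ y.2 * (u * x.2) by ring, mul_comm]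
      · exact Nat.Coprime.pow_left _ (hcop.coprime_dvd_right ⟨_, hx.symm⟩)
    · intro x z hz
      rw [← sqrtCount_mul_sq ((hcop.coprime_dvd_right hz).symm.pow_right (y.1 + r))
          (2 ^ y.2 * (u * x))]
      push_cast
      ring_nf
    · rw [← Int.isCoprime_iff_gcd_eq_one]
      exact (isCoprime_mul_unit_left_left hu _ _).2
        (IsCoprime.pow_left (Nat.isCoprime_iff_coprime.2 hcop))
  simp only [hinner]
  refine (Multiset.sum_map_sum_map (antidiagonal k).val L
    (f := fun y x => jacobiSym x.1 x.2 * jacobiSym (u * 2 ^ y.2) x.2 *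
      (sqrtCount (2 ^ (y.1 + r)) (2 ^ y.2 * (u * x.1)) : ℤ))).trans ?_
  refine congrArg _ (Multiset.map_congr rfl fun x _ => ?_)
  rw [mul_sum, mul_sum]
  refine sum_congr rfl fun y _ => ?_
  rw [jacobiSym.mul_left, jacobiSym.pow_left]
  ring

open Finset in
/-- The arithmetic identity behind the theorem, in terms of square roots modulo divisors. -/
lemma two_mul_sum_sqrtCount {n : ℕ} (hn : n ≠ 0) :
    2 * ∑ x ∈ n.divisorsAntidiagonal, sqrtCount x.1 x.2 =
      ∑ x ∈ n.divisorsAntidiagonal, (sqrtCount (4 * x.1) x.2 + sqrtCount (4 * x.1) (-x.2)) := by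
  obtain ⟨k, m, hm, rfl⟩ := Nat.exists_eq_pow_mul_and_not_dvd hn 2 (by norm_num)
  have hm : Odd m := by rwa [← Nat.not_even_iff_odd, even_iff_two_dvd]
  obtain ⟨L, hswap, hdvd, hL⟩ := exists_symmetric_jacobiSym_sum hm
  have h0 := sum_divisorsAntidiagonal_sqrtCount hm hL k 0 isUnit_one
  have h1 := sum_divisorsAntidiagonal_sqrtCount hm hL k 2 isUnit_one
  have h2 := sum_divisorsAntidiagonal_sqrtCount hm hL k 2 isUnit_one.neg
  simp only [pow_zero, one_mul, neg_mul, jacobiSym.one_left, add_zero,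
    show (2 : ℕ) ^ 2 = 4 by rfl] at h0 h1 h2
  zify
  rw [sum_add_distrib, h0, h1, h2, ← Multiset.sum_map_add, ← hswap, Multiset.map_map,
    ← Multiset.sum_map_mul_left, hswap]
  refine congrArg _ (Multiset.map_congr rfl fun x hx => ?_)
  obtain ⟨hx1, hx2⟩ := hdvd x hx
  have := jacobiSym_mul_sum_antidiagonal_two_pow (hm.of_dvd_nat hx1) (hm.of_dvd_nat hx2) k
  simp only [Function.comp_apply, Prod.fst_swap, Prod.snd_swap]
  linear_combination -this

open Finset in
lemma card_quot_eq_card_finset {α β : Type*} {r : α → α → Prop} (f : α → β) (s : Finset β)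
    (hr : ∀ x y, r x y ↔ f x = f y) (hs : ∀ b, b ∈ s ↔ ∃ x, f x = b) :
    Nat.card (Quot r) = #s := by
  rw [← Nat.card_eq_finsetCard]
  refine Nat.card_congr (Equiv.ofBijective
    (Quot.lift (fun x => (⟨f x, (hs _).2 ⟨x, rfl⟩⟩ : s))
      fun x y h => Subtype.ext ((hr x y).1 h)) ⟨?_, ?_⟩)
  · rintro ⟨x⟩ ⟨y⟩ h
    exact Quot.sound ((hr x y).2 (Subtype.ext_iff.1 h))
  · rintro ⟨b, hb⟩
    obtain ⟨x, rfl⟩ := (hs b).1 hb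
    exact ⟨Quot.mk _ x, rfl⟩

open Finset in
lemma sum_int_divisorsAntidiag {n : ℤ} (F : ℕ → ℤ → ℕ) :
    ∑ x ∈ n.divisorsAntidiag, F x.1.natAbs x.2 =
      ∑ x ∈ n.natAbs.divisorsAntidiagonal, (F x.1 x.2 + F x.1 (-x.2)) := by
  obtain ⟨m, rfl | rfl⟩ := n.eq_nat_or_neg
  · rw [Int.divisorsAntidiag_natCast, sum_disjUnion, sum_map, sum_map, ← sum_add_distrib]
    simp
  · rw [Int.divisorsAntidiag_neg_natCast, sum_disjUnion, sum_map, sum_map, ← sum_add_distrib]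
    simp [add_comm]

lemma quadEquiv_iff {p q : ℤ × ℤ × ℤ} (hp : p.1 ≠ 0) :
    quadEquiv p q ↔ p.1 = q.1 ∧ p.2.1 ^ 2 - 4 * p.1 * p.2.2 = q.2.1 ^ 2 - 4 * q.1 * q.2.2 ∧
      2 * p.1 ∣ q.2.1 - p.2.1 := by
  obtain ⟨a, b, c⟩ := p
  obtain ⟨a', b', c'⟩ := q
  simp only [quadEquiv, Prod.mk.injEq] at hp ⊢
  constructor
  · rintro ⟨t, rfl, rfl, rfl⟩
    exact ⟨rfl, by ring, t, by ring⟩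
  · rintro ⟨rfl, hD, t, ht⟩
    obtain rfl : b' = b + 2 * a * t := by linarith
    refine ⟨t, rfl, rfl, mul_left_cancel₀ (mul_ne_zero four_ne_zero hp) ?_⟩
    linarith

lemma toNat_emod_eq_iff {m : ℤ} (hm : m ≠ 0) (x y : ℤ) :
    (x % m).toNat = (y % m).toNat ↔ m ∣ y - x := by
  have := Int.emod_nonneg x hm
  have := Int.emod_nonneg y hm
  rw [← Int.modEq_iff_dvd, Int.ModEq]
  omega

lemma toNat_natCast_emod {m : ℤ} {b : ℕ} (hb : b < m.natAbs) : ((b : ℤ) % m).toNat = b := by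
  rw [← Int.emod_abs, Int.abs_eq_natAbs, Int.emod_eq_of_lt (by omega) (by omega),
    Int.toNat_natCast]

lemma toNat_emod_lt {m : ℤ} (hm : m ≠ 0) (x : ℤ) : (x % m).toNat < m.natAbs := by
  have := Int.emod_nonneg x hm
  have := Int.emod_lt x hm
  omega

lemma fst_ne_zero_of_superdisc_ne_zero {p : ℤ × ℤ × ℤ} (h : superdisc p ≠ 0) : p.1 ≠ 0 := by
  rintro hp
  simp [superdisc, hp] at h

open Finset in
lemma quadCount_eq_sum {n : ℤ} (hn : n ≠ 0) :
    quadCount n (fun _ => True) = ∑ x ∈ n.divisorsAntidiag,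
      #((range (2 * x.1.natAbs)).filter fun b : ℕ =>
        4 * (x.1.natAbs : ℤ) ∣ (b : ℤ) ^ 2 - x.2) := by
  rw [← card_sigma]
  refine card_quot_eq_card_finset (fun p => ⟨(p.1.1, p.1.2.1 ^ 2 - 4 * p.1.1 * p.1.2.2),
    (p.1.2.1 % (2 * p.1.1)).toNat⟩) _ ?_ ?_
  · rintro ⟨p, hp, -⟩ ⟨q, hq, -⟩
    have ha := fst_ne_zero_of_superdisc_ne_zero (hp.trans_ne hn)
    simp only [quadEquiv_iff ha, Sigma.mk.injEq, heq_eq_eq, Prod.mk.injEq, and_assoc]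
    refine and_congr_right fun h => and_congr_right fun _ => ?_
    rw [← h, toNat_emod_eq_iff (mul_ne_zero two_ne_zero ha)]
  · rintro ⟨⟨a, D⟩, b⟩
    simp only [mem_sigma, Int.mem_divisorsAntidiag, mem_filter, mem_range]
    constructor
    · rintro ⟨⟨hD, -⟩, hb, hdvd⟩
      obtain ⟨c, hc⟩ : 4 * a ∣ (b : ℤ) ^ 2 - D := by
        rwa [← Int.natAbs_dvd, Int.natAbs_mul, Nat.cast_mul]
      have hc : (b : ℤ) ^ 2 - 4 * a * c = D := by linarith
      refine ⟨⟨(a, b, c), by rw [superdisc, hc, hD], trivial⟩, ?_⟩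
      simp only [hc]
      rw [toNat_natCast_emod (by rwa [Int.natAbs_mul])]
    · rintro ⟨⟨⟨a', b', c⟩, hp, _⟩, h⟩
      have ha := fst_ne_zero_of_superdisc_ne_zero (hp.trans_ne hn)
      simp only [Sigma.mk.injEq, heq_eq_eq, Prod.mk.injEq] at h
      obtain ⟨⟨rfl, rfl⟩, rfl⟩ := h
      have ha2 : 2 * a' ≠ 0 := mul_ne_zero two_ne_zero ha
      refine ⟨⟨hp, hn⟩, by simpa [Int.natAbs_mul] using toNat_emod_lt ha2 b', ?_⟩
      rw [Int.toNat_of_nonneg (Int.emod_nonneg b' ha2), Int.emod_def,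
        show 4 * (a'.natAbs : ℤ) = (4 * a').natAbs by simp [Int.natAbs_mul], Int.natAbs_dvd]
      exact ⟨c - b' * (b' / (2 * a')) + a' * (b' / (2 * a')) ^ 2, by ring⟩

open Finset in
lemma quadCount_even_pos_eq_sum {n : ℤ} (hn : n ≠ 0) :
    quadCount (4 * n) (fun p => 2 ∣ p.2.1 ∧ 0 < p.2.1 ^ 2 - 4 * p.1 * p.2.2) =
      ∑ x ∈ n.divisorsAntidiag with 0 < x.2,
        #((range x.1.natAbs).filter fun b : ℕ => (x.1.natAbs : ℤ) ∣ (b : ℤ) ^ 2 - x.2) := by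
  have hn4 : 4 * n ≠ 0 := mul_ne_zero four_ne_zero hn
  rw [← card_sigma]
  refine card_quot_eq_card_finset (fun p => ⟨(p.1.1, (p.1.2.1 / 2) ^ 2 - p.1.1 * p.1.2.2),
    (p.1.2.1 / 2 % p.1.1).toNat⟩) _ ?_ ?_
  · rintro ⟨⟨a, b, c⟩, hp, hb, -⟩ ⟨⟨a', b', c'⟩, hq, hb', -⟩
    obtain ⟨b, rfl⟩ : 2 ∣ b := hb
    obtain ⟨b', rfl⟩ : 2 ∣ b' := hb'
    have ha := fst_ne_zero_of_superdisc_ne_zero (hp.trans_ne hn4)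
    simp only [quadEquiv_iff ha, Sigma.mk.injEq, heq_eq_eq, Prod.mk.injEq, and_assoc,
      Int.mul_ediv_cancel_left _ (two_ne_zero' ℤ)]
    refine and_congr_right fun h => and_congr ?_ ?_
    · constructor <;> intro _ <;> linarith
    · rw [← h, toNat_emod_eq_iff ha, ← mul_sub, mul_dvd_mul_iff_left two_ne_zero]
  · rintro ⟨⟨a, D⟩, b⟩
    simp only [mem_sigma, Int.mem_divisorsAntidiag, mem_filter, mem_range]
    constructor
    · rintro ⟨⟨⟨hD, -⟩, hpos⟩, hb, hdvd⟩
      obtain ⟨c, hc⟩ : a ∣ (b : ℤ) ^ 2 - D := by rwa [← Int.natAbs_dvd]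
      have hc : (b : ℤ) ^ 2 - a * c = D := by linarith
      have hc4 : (2 * b : ℤ) ^ 2 - 4 * a * c = 4 * D := by linarith
      refine ⟨⟨(a, 2 * b, c), ?_, dvd_mul_right _ _, ?_⟩, ?_⟩
      · rw [superdisc, hc4, ← hD]
        ring
      · simp only [hc4]
        positivity
      · simp only [Int.mul_ediv_cancel_left _ (two_ne_zero' ℤ), hc, toNat_natCast_emod hb]
    · rintro ⟨⟨⟨a', b', c⟩, hp, hb', hpos⟩, h⟩
      obtain ⟨b', rfl⟩ : 2 ∣ b' := hb'
      have ha := fst_ne_zero_of_superdisc_ne_zero (hp.trans_ne hn4)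
      simp only [Sigma.mk.injEq, heq_eq_eq, Prod.mk.injEq,
        Int.mul_ediv_cancel_left _ (two_ne_zero' ℤ)] at h
      obtain ⟨⟨rfl, rfl⟩, rfl⟩ := h
      simp only [superdisc] at hp hpos
      refine ⟨⟨⟨by linarith, hn⟩, by linarith⟩, toNat_emod_lt ha b', ?_⟩
      rw [Int.toNat_of_nonneg (Int.emod_nonneg b' ha), Int.emod_def, Int.natAbs_dvd]
      exact ⟨c - 2 * b' * (b' / a') + a' * (b' / a') ^ 2, by ring⟩

/-- Quadratic Ohno–Nakagawa: `q₂⁺(4n) = q(n)` for every nonzero integer `n`. -/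
theorem quad_ON_first (n : ℤ) (hn : n ≠ 0) :
    quadCount (4 * n)
      (fun p => 2 ∣ p.2.1 ∧ 0 < p.2.1 ^ 2 - 4 * p.1 * p.2.2)
    = quadCount n (fun _ => True) := by
  rw [quadCount_eq_sum hn, quadCount_even_pos_eq_sum hn, Finset.sum_filter,
    sum_int_divisorsAntidiag fun a D => Finset.card ((Finset.range (2 * a)).filter fun b : ℕ =>
      4 * (a : ℤ) ∣ (b : ℤ) ^ 2 - D),
    sum_int_divisorsAntidiag fun a D => if 0 < D then Finset.card ((Finset.range a).filter
      fun b : ℕ => (a : ℤ) ∣ (b : ℤ) ^ 2 - D) else 0]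
  refine mul_left_cancel₀ two_ne_zero (Eq.trans ?_
    ((two_mul_sum_sqrtCount (Int.natAbs_ne_zero.2 hn)).trans ?_))
  · refine congrArg _ (Finset.sum_congr rfl fun x hx => ?_)
    obtain ⟨h1, h2⟩ := Nat.ne_zero_of_mem_divisorsAntidiagonal hx
    rw [if_pos (by omega), if_neg (by omega), sqrtCount_eq_card h1, add_zero]
  · rw [Finset.mul_sum]
    refine Finset.sum_congr rfl fun x hx => ?_
    obtain ⟨h1, -⟩ := Nat.ne_zero_of_mem_divisorsAntidiagonal hx
    rw [two_mul_card_half h1, two_mul_card_half h1, mul_add]
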